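/- Let B be a subset of ℝ that is simultaneously a Bernstein set and a subgroup of (ℝ, +). Then for any x₁, …, xₙ ∈ ℝ (n ≥ 1), the set U = (B + x₁) ∪ ⋯ ∪ (B + xₙ) and its complement ℝ \ U are both not Lebesgue measurable and both fail to have the Baire property in ℝ. -/

import Mathlib

open MeasureTheory

/-- A Bernstein set: a set `B ⊆ ℝ` such that every uncountable closed subset
`F` of `ℝ` meets both `B` and its complement. -/
def IsBernstein (B : Set ℝ) : Prop :=
  ∀ F : Set ℝ, IsClosed F → ¬F.Countable → (F ∩ B).Nonempty ∧ (F ∩ Bᶜ).Nonempty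

/-- A set `A ⊆ ℝ` has the Baire property if `A = O ∆ M` for some open `O`
and meager `M`. -/
def HasBaireProperty (A : Set ℝ) : Prop :=
  ∃ O M : Set ℝ, IsOpen O ∧ IsMeagre M ∧ A = symmDiff O M

theorem exists_isClosed_subset_not_countable {s : Set ℝ} (hs : MeasurableSet s)
    (hunc : ¬s.Countable) : ∃ F ⊆ s, IsClosed F ∧ ¬F.Countable := by
  obtain ⟨f, hfs, hfc, hfi⟩ :
      ∃ f : (ℕ → Bool) → ℝ, Set.range f ⊆ s ∧ Continuous f ∧ Function.Injective f := by
    obtain ⟨t, hle, ht, s_closed, -⟩ := hs.isClopenable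
    obtain ⟨f, hfs, hfc, hfi⟩ :=
      @IsClosed.exists_nat_bool_injection_of_not_countable ℝ t ht s s_closed hunc
    exact ⟨f, hfs, continuous_le_rng hle hfc, hfi⟩
  refine ⟨Set.range f, hfs, (isCompact_range hfc).isClosed, fun hc => ?_⟩
  have : Countable (Set.range f) := hc
  have : Countable (ℕ → Bool) := (Set.rangeFactorization_injective.2 hfi).countable
  have h : Cardinal.mk (ℕ → Bool) = Cardinal.continuum := by
    rw [← Cardinal.power_def]; simp
  exact Cardinal.aleph0_lt_continuum.not_ge (h ▸ Cardinal.mk_le_aleph0)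

theorem IsBernstein.compl {A : Set ℝ} (hA : IsBernstein A) : IsBernstein Aᶜ := fun F hF hunc =>
  ⟨(hA F hF hunc).2, by simpa using (hA F hF hunc).1⟩

theorem IsBernstein.countable_of_subset {A s : Set ℝ} (hA : IsBernstein A)
    (hs : MeasurableSet s) (hsA : s ⊆ A) : s.Countable := by
  by_contra hunc
  obtain ⟨F, hFs, hF, hFunc⟩ := exists_isClosed_subset_not_countable hs hunc
  obtain ⟨y, hyF, hyA⟩ := (hA F hF hFunc).2
  exact hyA (hsA (hFs hyF))

theorem IsBernstein.volume_eq_zero {A : Set ℝ} (hA : IsBernstein A)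
    (h : NullMeasurableSet A volume) : volume A = 0 := by
  obtain ⟨s, hsA, hs, hae⟩ := h.exists_measurable_subset_ae_eq
  rw [← measure_congr hae]
  exact (hA.countable_of_subset hs hsA).measure_zero volume

theorem IsBernstein.not_nullMeasurableSet {A : Set ℝ} (hA : IsBernstein A) :
    ¬NullMeasurableSet A volume := fun h => by
  have hle := measure_union_le (μ := volume) A Aᶜ
  simp [hA.volume_eq_zero h, hA.compl.volume_eq_zero h.compl] at hle

theorem not_countable_of_mem_residual {t : Set ℝ} (ht : t ∈ residual ℝ) : ¬t.Countable := by
  intro hc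
  have h : (⋂ y ∈ t, ({y}ᶜ : Set ℝ)) ∈ residual ℝ :=
    (countable_bInter_mem hc).2 fun y _ =>
      residual_of_dense_open isOpen_compl_singleton (dense_compl_singleton y)
  obtain ⟨y, hyt, hy⟩ := (dense_of_mem_residual (Filter.inter_mem ht h)).nonempty
  exact Set.mem_iInter₂.1 hy y hyt rfl

theorem IsBernstein.not_hasBaireProperty {A : Set ℝ} (hA : IsBernstein A) :
    ¬HasBaireProperty A := by
  rintro ⟨O, M, hO, hM, rfl⟩
  obtain ⟨t, htM, htG, htd⟩ := mem_residual.1 hM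
  have hin : (t ∩ O).Countable :=
    hA.countable_of_subset (htG.measurableSet.inter hO.measurableSet)
      fun y hy => Or.inl ⟨hy.2, htM hy.1⟩
  have hout : (t \ O).Countable :=
    hA.compl.countable_of_subset (htG.measurableSet.diff hO.measurableSet) fun y hy h =>
      h.elim (fun h => hy.2 h.1) (fun h => htM hy.1 h.1)
  refine not_countable_of_mem_residual (residual_of_dense_Gδ htG htd) ?_
  rw [← Set.inter_union_sdiff t O]
  exact hin.union hout

theorem IsBernstein.exists_add_mem {B F : Set ℝ} (hB : IsBernstein B) (hF : IsClosed F)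
    (hunc : ¬F.Countable) (t : ℝ) : ∃ b ∈ B, b + t ∈ F := by
  have hunc' : ¬((fun y => y + t) ⁻¹' F).Countable := fun hc => hunc <| by
    rw [← Set.image_preimage_eq F (add_right_surjective t)]
    exact hc.image _
  obtain ⟨b, hbF, hb⟩ := (hB _ (hF.preimage (continuous_add_const t)) hunc').1
  exact ⟨b, hb, hbF⟩

/-- Finitely many cosets of a proper subgroup of the reals do not cover the line. -/
theorem AddSubgroup.exists_forall_sub_notMem_of_ne_top {G : AddSubgroup ℝ} (hG : G ≠ ⊤)
    {ι : Type*} [Finite ι] (x : ι → ℝ) : ∃ t, ∀ i, t - x i ∉ G := by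
  by_contra! h
  have hsurj : Function.Surjective fun i => (x i : ℝ ⧸ G) := fun q => by
    obtain ⟨t, rfl⟩ := QuotientAddGroup.mk_surjective q
    obtain ⟨i, hi⟩ := h t
    exact ⟨i, QuotientAddGroup.eq.2 (by rwa [neg_add_eq_sub])⟩
  have : Finite (ℝ ⧸ G) := Finite.of_surjective _ hsurj
  have hk : (G.index : ℝ) ≠ 0 := Nat.cast_ne_zero.2 AddSubgroup.index_ne_zero_of_finite
  refine hG ((AddSubgroup.eq_top_iff' G).2 fun r => ?_)
  have := G.nsmul_index_mem (r / G.index)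
  rwa [nsmul_eq_mul, mul_div_cancel₀ _ hk] at this

theorem IsBernstein.iUnion_translate {G : AddSubgroup ℝ} (hG : IsBernstein (G : Set ℝ))
    {ι : Type*} [Finite ι] [Nonempty ι] (x : ι → ℝ) :
    IsBernstein (⋃ i, (fun b => b + x i) '' (G : Set ℝ)) := by
  have htop : G ≠ ⊤ := by
    rintro rfl
    obtain ⟨y, -, hy⟩ := (hG Set.univ isClosed_univ Set.not_countable_univ).2
    exact hy trivial
  obtain ⟨t, ht⟩ := AddSubgroup.exists_forall_sub_notMem_of_ne_top htop x
  refine fun F hF hunc => ⟨?_, ?_⟩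
  · obtain ⟨i⟩ := ‹Nonempty ι›
    obtain ⟨b, hb, hbF⟩ := hG.exists_add_mem hF hunc (x i)
    exact ⟨b + x i, hbF, Set.mem_iUnion.2 ⟨i, b, hb, rfl⟩⟩
  · obtain ⟨b, hb, hbF⟩ := hG.exists_add_mem hF hunc t
    refine ⟨b + t, hbF, fun hU => ?_⟩
    obtain ⟨i, c, hc, hci⟩ := Set.mem_iUnion.1 hU
    refine ht i ?_
    have heq : t - x i = c - b := by
      have : c + x i = b + t := hci
      linarith
    rw [heq]
    exact G.sub_mem hc hb

theorem stmt_5 (B : Set ℝ) (hB : IsBernstein B)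
    (hsub : ∃ G : AddSubgroup ℝ, (G : Set ℝ) = B)
    (n : ℕ) (x : Fin (n + 1) → ℝ)
    (U : Set ℝ) (hU : U = ⋃ i, (fun b => b + x i) '' B) :
    ¬NullMeasurableSet U volume ∧ ¬NullMeasurableSet Uᶜ volume ∧
    ¬HasBaireProperty U ∧ ¬HasBaireProperty Uᶜ := by
  obtain ⟨G, rfl⟩ := hsub
  subst hU
  have h := hB.iUnion_translate x
  exact ⟨h.not_nullMeasurableSet, h.compl.not_nullMeasurableSet,
    h.not_hasBaireProperty, h.compl.not_hasBaireProperty⟩
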